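/- Let X be a pseudometric space and let A ⊆ S be finite subsets of X with A nonempty. Define the optimal tour cost of a finite nonempty set B ⊆ X as the minimum, over all lists enumerating the elements of B exactly once, of the closed tour length of that list. Then the optimal tour cost of S is at most the optimal tour cost of A plus ∑_{v ∈ S \ A} 2·max_{m ∈ A} d(v, m). -/

import Mathlib

/-- The closed tour length of a list of points in a pseudometric space: the sum of the
distances between consecutive points, plus the return distance from the last point back
to the first (obtained by pairing the list with its rotation by one). -/
noncomputable def listClosedTour {X : Type*} [PseudoMetricSpace X] (l : List X) : ℝ :=
  (List.zipWith dist l (l.rotate 1)).sum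

/-- The optimal tour cost of a finite set `A` of points: the minimum, over all lists
enumerating the elements of `A` exactly once, of the closed tour length of that list. -/
noncomputable def optTourCost {X : Type*} [PseudoMetricSpace X] (A : Finset X) : ℝ :=
  sInf (listClosedTour '' {l : List X | l.Perm A.toList})

theorem listClosedTour_insert {X : Type*} [PseudoMetricSpace X] (a v : X) (t : List X) :
    listClosedTour (a :: v :: t) ≤ listClosedTour (a :: t) + 2 * dist v a := by
  cases t with
  | nil => simp [listClosedTour, dist_comm a v]; linarith
  | cons b t =>
    simp [listClosedTour, dist_comm a v]
    linarith [dist_triangle v a b]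

theorem listClosedTour_insert_list {X : Type*} [PseudoMetricSpace X] (a : X) (w t : List X) :
    listClosedTour (a :: (w ++ t)) ≤
      listClosedTour (a :: t) + (w.map (fun v => 2 * dist v a)).sum := by
  induction w with
  | nil => simp
  | cons v w ih =>
    have := listClosedTour_insert a v (w ++ t)
    simp only [List.cons_append, List.map_cons, List.sum_cons]
    linarith

theorem listClosedTour_nonneg {X : Type*} [PseudoMetricSpace X] (l : List X) :
    0 ≤ listClosedTour l := by
  apply List.sum_nonneg
  intro x hx
  rw [List.mem_iff_getElem] at hx
  obtain ⟨i, hi, rfl⟩ := hx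
  rw [List.getElem_zipWith]
  exact dist_nonneg

/-- Core inequality for the validity of the logic-based Benders optimality cuts: for finite
sets `A ⊆ S` with `A` nonempty, the optimal tour cost of `S` is at most the optimal tour
cost of `A` plus `∑_{v ∈ S \ A} 2 * max_{m ∈ A} d(v, m)`. -/
theorem optTourCost_insert_bound {X : Type*} [PseudoMetricSpace X] [DecidableEq X]
    (A S : Finset X) (hA : A.Nonempty) (hAS : A ⊆ S) :
    optTourCost S ≤ optTourCost A + ∑ v ∈ S \ A, 2 * A.sup' hA (fun m => dist v m) := by
  rw [← sub_le_iff_le_add]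
  refine le_csInf ⟨_, A.toList, List.Perm.refl _, rfl⟩ ?_
  rintro _ ⟨l, hl, rfl⟩
  rw [sub_le_iff_le_add]
  have hl : l.Perm A.toList := hl
  cases l with
  | nil =>
    obtain ⟨x, hx⟩ := hA
    rw [← Finset.mem_toList, ← hl.mem_iff] at hx
    simp at hx
  | cons a t =>
    have ha : a ∈ A := by
      rw [← Finset.mem_toList, ← hl.mem_iff]; simp
    have hnd : (a :: t).Nodup := hl.nodup_iff.mpr A.nodup_toList
    have hmem : ∀ x, x ∈ a :: t ↔ x ∈ A := fun x => by rw [hl.mem_iff, Finset.mem_toList]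
    have hp0 : (a :: ((S \ A).toList ++ t)).Perm ((S \ A).toList ++ a :: t) :=
      List.perm_middle.symm
    have hp : (a :: ((S \ A).toList ++ t)).Perm S.toList := by
      refine hp0.trans ?_
      rw [List.perm_ext_iff_of_nodup _ S.nodup_toList]
      · intro x
        rw [List.mem_append, hmem, Finset.mem_toList, Finset.mem_toList, Finset.mem_sdiff]
        have := @hAS x
        tauto
      · rw [List.nodup_append']
        refine ⟨Finset.nodup_toList _, hnd, ?_⟩
        intro x hx hx'
        rw [hmem] at hx'
        rw [Finset.mem_toList, Finset.mem_sdiff] at hx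
        exact hx.2 hx'
    have h1 : optTourCost S ≤ listClosedTour (a :: ((S \ A).toList ++ t)) := by
      refine csInf_le ⟨0, ?_⟩ ⟨_, hp, rfl⟩
      rintro _ ⟨l, -, rfl⟩
      exact listClosedTour_nonneg l
    have h2 := listClosedTour_insert_list a (S \ A).toList t
    rw [Finset.sum_map_toList] at h2
    have h3 : ∑ v ∈ S \ A, 2 * dist v a ≤ ∑ v ∈ S \ A, 2 * A.sup' hA (fun m => dist v m) := by
      refine Finset.sum_le_sum fun v _ => ?_
      have := Finset.le_sup' (fun m => dist v m) ha
      linarith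
    linarith
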